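/- arXiv:1711.04724 — 2 statements merged into one kernel-verified Lean document; each statement's English description precedes it below -/
import Mathlib

section
/- Let A be a unital C*-algebra, let E and F be inner product A-modules, let T : E → F be a local mapping, and let p ∈ A be a projection (p = p* = p²). Then T(px) = pT(x) for all x ∈ E. Consequently, T(ax) = aT(x) for every element a of A that is a linear combination of projections. -/
/-- An inner product module over a unital C*-algebra `A`: a (left, unital) `A`-module `E`
together with an `A`-valued inner product which is `ℂ`-linear and `A`-linear in the first
variable, conjugate symmetric, and positive definite. -/
structure CStarInnerProductModule (A E : Type*) [CStarAlgebra A]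
    [PartialOrder A] [StarOrderedRing A]
    [AddCommGroup E] [Module ℂ E] [SMul A E] where
  inner : E → E → A
  add_left : ∀ x y z : E, inner (x + y) z = inner x z + inner y z
  smulC_left : ∀ (c : ℂ) (x y : E), inner (c • x) y = c • inner x y
  smulA_left : ∀ (a : A) (x y : E), inner (a • x) y = a * inner x y
  star_inner : ∀ x y : E, star (inner x y) = inner y x
  inner_self_nonneg : ∀ x : E, 0 ≤ inner x x
  inner_self_eq_zero : ∀ x : E, inner x x = 0 ↔ x = 0
  smul_add : ∀ (a : A) (x y : E), a • (x + y) = a • x + a • y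
  add_smul : ∀ (a b : A) (x : E), (a + b) • x = a • x + b • x
  mul_smul : ∀ (a b : A) (x : E), (a * b) • x = a • (b • x)
  smul_assoc : ∀ (c : ℂ) (a : A) (x : E), (c • a) • x = c • (a • x)
  one_smul : ∀ x : E, (1 : A) • x = x

theorem CStarInnerProductModule.zero_smul {A E : Type*} [CStarAlgebra A]
    [PartialOrder A] [StarOrderedRing A] [AddCommGroup E] [Module ℂ E] [SMul A E]
    (M : CStarInnerProductModule A E) (x : E) : (0 : A) • x = 0 := by
  have h := M.add_smul 0 0 x
  rwa [add_zero, left_eq_add] at h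

/-- A local mapping commutes with every projection of the unital C*-algebra `A`, and hence with
every linear combination of projections.  Here `T : E → F` is local when it is `ℂ`-linear and
`a • x = 0` implies `a • T x = 0`. -/
theorem local_map_commutes_with_projections
    {A E F : Type*} [CStarAlgebra A] [PartialOrder A] [StarOrderedRing A]
    [AddCommGroup E] [Module ℂ E] [SMul A E]
    [AddCommGroup F] [Module ℂ F] [SMul A F]
    (ME : CStarInnerProductModule A E) (MF : CStarInnerProductModule A F)
    (T : E → F)
    (hTadd : ∀ x y : E, T (x + y) = T x + T y)
    (hTsmulC : ∀ (c : ℂ) (x : E), T (c • x) = c • T x)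
    (hTlocal : ∀ (a : A) (x : E), a • x = 0 → a • T x = 0)
    (p : A) (hp₁ : star p = p) (hp₂ : p * p = p) :
    (∀ x : E, T (p • x) = p • T x) ∧
      ∀ a ∈ Submodule.span ℂ {q : A | star q = q ∧ q * q = q},
        ∀ x : E, T (a • x) = a • T x := by
  have commutes : ∀ q : A, q * q = q → ∀ x : E, T (q • x) = q • T x := by
    intro q hq x
    have decompE : q • x + (1 - q) • x = x := by
      rw [← ME.add_smul, add_sub_cancel, ME.one_smul]
    have decompF : q • T (q • x) + (1 - q) • T (q • x) = T (q • x) := by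
      rw [← MF.add_smul, add_sub_cancel, MF.one_smul]
    have h₁ : (1 - q) • T (q • x) = 0 := hTlocal _ _ (by
      rw [← ME.mul_smul, sub_mul, one_mul, hq, sub_self, ME.zero_smul])
    have h₂ : q • T ((1 - q) • x) = 0 := hTlocal _ _ (by
      rw [← ME.mul_smul, mul_sub, mul_one, hq, sub_self, ME.zero_smul])
    calc T (q • x) = q • T (q • x) := by rw [h₁, add_zero] at decompF; exact decompF.symm
      _ = q • T (q • x) + q • T ((1 - q) • x) := by rw [h₂, add_zero]
      _ = q • T x := by rw [← MF.smul_add, ← hTadd, decompE]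
  refine ⟨commutes p hp₂, fun a ha => ?_⟩
  induction ha using Submodule.span_induction with
  | mem q hq => exact commutes q hq.2
  | zero =>
    intro x
    rw [ME.zero_smul, MF.zero_smul]
    simpa using hTsmulC 0 0
  | add a b _ _ iha ihb =>
    intro x
    rw [ME.add_smul, hTadd, iha, ihb, MF.add_smul]
  | smul c a _ iha =>
    intro x
    rw [ME.smul_assoc, hTsmulC, iha, MF.smul_assoc]
end

section
/- Let A be a unital C*-algebra of real rank zero with identity e, and let E and F be Hilbert A-modules. Suppose T, S : E → F are A-linear mappings such that for all x, y ∈ E, ⟨x, y⟩ = 0 implies ⟨T(x), S(y)⟩ = 0, and suppose there exists z ∈ E such that ⟨z, z⟩ is invertible in A and ⟨T(z), S(z)⟩ is self-adjoint. Then there exists a self-adjoint element γ in the center Z(A) of A such that ⟨T(x), S(y)⟩ = γ·⟨x, y⟩ for all x, y ∈ E. -/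
/-- A Hilbert module over a unital C*-algebra `A`: a (left, unital) `A`-module `E` together
with an `A`-valued inner product which is `ℂ`-linear and `A`-linear in the first variable,
conjugate symmetric and positive definite, such that the norm of `E` is the induced norm
`‖x‖ = ‖⟪x, x⟫‖^(1/2)` (completeness is the type class `CompleteSpace E`). -/
structure CStarNormedInnerProductModule (A E : Type*) [CStarAlgebra A]
    [PartialOrder A] [StarOrderedRing A]
    [NormedAddCommGroup E] [Module ℂ E] [SMul A E] where
  inner : E → E → A
  add_left : ∀ x y z : E, inner (x + y) z = inner x z + inner y z
  smulC_left : ∀ (c : ℂ) (x y : E), inner (c • x) y = c • inner x y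
  smulA_left : ∀ (a : A) (x y : E), inner (a • x) y = a * inner x y
  star_inner : ∀ x y : E, star (inner x y) = inner y x
  inner_self_nonneg : ∀ x : E, 0 ≤ inner x x
  inner_self_eq_zero : ∀ x : E, inner x x = 0 ↔ x = 0
  smul_add : ∀ (a : A) (x y : E), a • (x + y) = a • x + a • y
  add_smul : ∀ (a b : A) (x : E), (a + b) • x = a • x + b • x
  mul_smul : ∀ (a b : A) (x : E), (a * b) • x = a • (b • x)
  smul_assoc : ∀ (c : ℂ) (a : A) (x : E), (c • a) • x = c • (a • x)
  one_smul : ∀ x : E, (1 : A) • x = x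
  norm_eq : ∀ x : E, ‖x‖ ^ 2 = ‖inner x x‖

section Centrality

variable {A : Type*} [CStarAlgebra A]

/-- An invertible self-adjoint element `b` is within `‖b‖ / 2` of a multiple of a symmetry. -/
theorem IsSelfAdjoint.exists_symmetry_norm_sub_le {b : A} (hb : IsSelfAdjoint b)
    (hu : IsUnit b) :
    ∃ u : A, IsSelfAdjoint u ∧ u * u = 1 ∧ ‖b - (‖b‖ / 2) • u‖ ≤ ‖b‖ / 2 := by
  cases subsingleton_or_nontrivial A
  · exact ⟨0, .zero A, Subsingleton.elim _ _, by simp [Subsingleton.elim b 0]⟩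
  have h0 : ∀ x ∈ spectrum ℝ b, x ≠ 0 := fun x hx h => spectrum.zero_notMem ℝ hu (h ▸ hx)
  have hc : ContinuousOn (fun x : ℝ => x / |x|) (spectrum ℝ b) :=
    continuousOn_id.div continuous_abs.continuousOn fun x hx => abs_ne_zero.2 (h0 x hx)
  refine ⟨cfc (fun x : ℝ => x / |x|) b, cfc_predicate _ b, ?_, ?_⟩
  · rw [← cfc_mul _ _ b hc hc, ← cfc_one ℝ b]
    refine cfc_congr fun x hx => ?_
    have hx0 := h0 x hx
    simp only [div_mul_div_comm, abs_mul_abs_self, Pi.one_apply]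
    exact div_self (mul_ne_zero hx0 hx0)
  · have hcfc : b - (‖b‖ / 2) • cfc (fun x : ℝ => x / |x|) b
        = cfc (fun x : ℝ => x - (‖b‖ / 2) • (x / |x|)) b := by
      rw [cfc_sub (fun x : ℝ => x) (fun x => (‖b‖ / 2) • (x / |x|)) b continuousOn_id
        (hc.const_smul (‖b‖ / 2)), cfc_smul _ _ b hc, cfc_id' ℝ b]
    rw [hcfc]
    refine norm_cfc_le (by positivity) fun x hx => ?_
    have hx0 := h0 x hx
    have hxb : |x| ≤ ‖b‖ := spectrum.norm_le_norm_of_mem hx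
    rw [Real.norm_eq_abs, smul_eq_mul]
    rcases lt_or_gt_of_ne hx0 with h | h
    · rw [abs_of_neg h] at hxb ⊢
      rw [div_neg, div_self hx0, abs_le]
      constructor <;> linarith
    · rw [abs_of_pos h] at hxb ⊢
      rw [div_self hx0, abs_le]
      constructor <;> linarith

/-- If `A` has real rank zero, an element commuting with every symmetry commutes with every
self-adjoint element. -/
theorem commute_of_commute_symmetries
    (hRR0 : ∀ a : A, IsSelfAdjoint a → ∀ ε : ℝ, 0 < ε →
      ∃ b : A, IsSelfAdjoint b ∧ IsUnit b ∧ ‖a - b‖ < ε)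
    {g : A} (hg : ∀ u : A, IsSelfAdjoint u → u * u = 1 → Commute u g)
    {a : A} (ha : IsSelfAdjoint a) : Commute a g := by
  have hK : ∀ c : A, ‖c * g - g * c‖ ≤ 2 * ‖g‖ * ‖c‖ := fun c =>
    calc ‖c * g - g * c‖ ≤ ‖c * g‖ + ‖g * c‖ := norm_sub_le _ _
      _ ≤ ‖c‖ * ‖g‖ + ‖g‖ * ‖c‖ := add_le_add (norm_mul_le _ _) (norm_mul_le _ _)
      _ = 2 * ‖g‖ * ‖c‖ := by ring
  have halve : ∀ n : ℕ, ∀ c : A, IsSelfAdjoint c →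
      ‖c * g - g * c‖ ≤ 2 * ‖g‖ * (1 / 2) ^ n * ‖c‖ := by
    intro n
    induction n with
    | zero => intro c _; simpa using hK c
    | succ n ih =>
      intro c hc
      set L : ℝ := 2 * ‖g‖ * (1 / 2) ^ n with hL
      have hL0 : 0 ≤ L := by positivity
      have key : ∀ ε : ℝ, 0 < ε →
          ‖c * g - g * c‖ ≤ L / 2 * ‖c‖ + (2 * ‖g‖ + L / 2) * ε := by
        intro ε hε
        obtain ⟨b, hb, hbu, hcb⟩ := hRR0 c hc ε hε
        obtain ⟨u, hu, huu, hbu'⟩ := hb.exists_symmetry_norm_sub_le hbu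
        have hug : u * g = g * u := hg u hu huu
        have hsplit : c * g - g * c = ((c - b) * g - g * (c - b))
            + ((b - (‖b‖ / 2) • u) * g - g * (b - (‖b‖ / 2) • u)) := by
          simp only [sub_mul, mul_sub, smul_mul_assoc, mul_smul_comm, hug]
          abel
        have hbc : ‖b‖ ≤ ‖c‖ + ε := by
          have := norm_sub_norm_le b c
          rw [norm_sub_rev] at this
          linarith
        have h1 := hK (c - b)
        have h2 := ih (b - (‖b‖ / 2) • u) (hb.sub ((IsSelfAdjoint.all _).smul hu))
        have h3 : 2 * ‖g‖ * ‖c - b‖ ≤ 2 * ‖g‖ * ε := by gcongr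
        have h4 : L * ‖b - (‖b‖ / 2) • u‖ ≤ L * ((‖c‖ + ε) / 2) := by
          gcongr
          linarith
        rw [hsplit]
        refine (norm_add_le _ _).trans ?_
        linarith
      have hlim : Filter.Tendsto (fun ε : ℝ => L / 2 * ‖c‖ + (2 * ‖g‖ + L / 2) * ε)
          (nhdsWithin 0 (Set.Ioi 0)) (nhds (L / 2 * ‖c‖ + (2 * ‖g‖ + L / 2) * 0)) :=
        (Continuous.tendsto (by fun_prop) 0).mono_left nhdsWithin_le_nhds
      have := ge_of_tendsto hlim (Filter.eventually_of_mem self_mem_nhdsWithin key)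
      calc ‖c * g - g * c‖ ≤ L / 2 * ‖c‖ + (2 * ‖g‖ + L / 2) * 0 := this
        _ = 2 * ‖g‖ * (1 / 2) ^ (n + 1) * ‖c‖ := by rw [hL]; ring
  have hlim : Filter.Tendsto (fun n : ℕ => 2 * ‖g‖ * (1 / 2 : ℝ) ^ n * ‖a‖)
      Filter.atTop (nhds (2 * ‖g‖ * 0 * ‖a‖)) :=
    ((tendsto_pow_atTop_nhds_zero_of_lt_one (by norm_num) (by norm_num)).const_mul _).mul_const _
  have h0 := ge_of_tendsto' hlim fun n => halve n a ha
  rw [mul_zero, zero_mul] at h0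
  exact sub_eq_zero.1 (norm_le_zero_iff.1 h0)

/-- In a C⋆-algebra of real rank zero, an element `g` such that `a * b = 0` implies
`a * g * b = 0` is central. -/
theorem mem_center_of_mul_eq_zero_imp
    (hRR0 : ∀ a : A, IsSelfAdjoint a → ∀ ε : ℝ, 0 < ε →
      ∃ b : A, IsSelfAdjoint b ∧ IsUnit b ∧ ‖a - b‖ < ε)
    {g : A} (hg : ∀ a b : A, a * b = 0 → a * g * b = 0) : g ∈ Set.center A := by
  have hsymm : ∀ u : A, IsSelfAdjoint u → u * u = 1 → Commute u g := by
    intro u _ huu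
    have h1 : (1 + u) * g * (1 - u) = 0 := hg _ _ (by noncomm_ring; simp [huu])
    have h2 : (1 - u) * g * (1 + u) = 0 := hg _ _ (by noncomm_ring; simp [huu])
    have h3 : (2 : ℂ) • (u * g - g * u) = 0 := by
      rw [two_smul]
      calc u * g - g * u + (u * g - g * u)
          = (1 + u) * g * (1 - u) - (1 - u) * g * (1 + u) := by noncomm_ring
        _ = 0 := by rw [h1, h2, sub_zero]
    exact sub_eq_zero.1 ((smul_eq_zero.1 h3).resolve_left two_ne_zero)
  have hsa : ∀ a : A, IsSelfAdjoint a → Commute a g := fun a ha =>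
    commute_of_commute_symmetries hRR0 hsymm ha
  rw [Semigroup.mem_center_iff]
  intro a
  rw [← realPart_add_I_smul_imaginaryPart a]
  exact (hsa _ (realPart a).2).add_left ((hsa _ (imaginaryPart a).2).smul_left Complex.I)

end Centrality

namespace CStarNormedInnerProductModule

variable {A E : Type*} [CStarAlgebra A] [PartialOrder A] [StarOrderedRing A]
  [NormedAddCommGroup E] [Module ℂ E] [SMul A E]

theorem inner_add_right (M : CStarNormedInnerProductModule A E) (x y w : E) :
    M.inner x (y + w) = M.inner x y + M.inner x w := by
  rw [← M.star_inner, M.add_left, star_add, M.star_inner, M.star_inner]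

theorem inner_smul_right (M : CStarNormedInnerProductModule A E) (a : A) (x y : E) :
    M.inner x (a • y) = M.inner x y * star a := by
  rw [← M.star_inner, M.smulA_left, star_mul, M.star_inner]

/-- An element of a Hilbert module with invertible square has a multiple with square `1`. -/
theorem exists_smul_inner_self_eq_one (M : CStarNormedInnerProductModule A E) {z : E}
    (hz : IsUnit (M.inner z z)) :
    ∃ h : A, IsSelfAdjoint h ∧ M.inner (h • z) (h • z) = 1 := by
  have hsa : IsSelfAdjoint (M.inner z z ^ (-(1 / 2) : ℝ)) := CFC.rpow_nonneg.isSelfAdjoint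
  refine ⟨_, hsa, ?_⟩
  rw [M.smulA_left, M.inner_smul_right, hsa.star_eq, ← mul_assoc]
  exact CFC.conjugate_rpow_neg_one_half _ (hz.isStrictlyPositive (M.inner_self_nonneg z))

/-- A sesquilinear form `t` on a Hilbert module that vanishes on orthogonal pairs is determined
by its value at `(z, z)`, if `z` has square `1` and that value is central. -/
theorem eq_mul_inner_of_orthogonality_preserving (M : CStarNormedInnerProductModule A E)
    {t : E → E → A} (add_left : ∀ x y w, t (x + y) w = t x w + t y w)
    (add_right : ∀ x y w, t x (y + w) = t x y + t x w)
    (smul_left : ∀ (a : A) x y, t (a • x) y = a * t x y)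
    (smul_right : ∀ (a : A) x y, t x (a • y) = t x y * star a)
    (ht : ∀ x y, M.inner x y = 0 → t x y = 0) {z : E} (hz : M.inner z z = 1)
    (hc : t z z ∈ Set.center A) (x y : E) : t x y = t z z * M.inner x y := by
  have left : ∀ x, t x z = M.inner x z * t z z := by
    intro x
    have h := ht (x + (-M.inner x z) • z) z (by rw [M.add_left, M.smulA_left, hz]; simp)
    rw [add_left, smul_left, neg_mul] at h
    exact add_neg_eq_zero.1 h
  have right : ∀ x y, M.inner x z = 1 → t x y = t x z * M.inner x y := by
    intro x y hx
    have h := ht x (y + (-star (M.inner x y)) • z)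
      (by rw [M.inner_add_right, M.inner_smul_right, hx]; simp)
    rw [add_right, smul_right, star_neg, star_star, mul_neg] at h
    exact add_neg_eq_zero.1 h
  have hu : M.inner (x + (1 - M.inner x z) • z) z = 1 := by
    rw [M.add_left, M.smulA_left, hz]; simp
  have h := right _ y hu
  rw [left _, hu, one_mul, add_left, smul_left, M.add_left, M.smulA_left, right z y hz, mul_add,
    ← mul_assoc, ← mul_assoc, ← (Semigroup.mem_center_iff.1 hc) (1 - M.inner x z)] at h
  exact add_right_cancel h

end CStarNormedInnerProductModule

/-- **Theorem 5.1**: let `A` be a unital C*-algebra of real rank zero, `E, F` Hilbert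
`A`-modules and `T, S : E → F` `A`-linear maps such that `⟪x, y⟫ = 0` implies
`⟪T x, S y⟫ = 0`.  If there is `z ∈ E` with `⟪z, z⟫` invertible and `⟪T z, S z⟫`
self-adjoint, then there is a self-adjoint `γ ∈ Z(A)` with `⟪T x, S y⟫ = γ * ⟪x, y⟫` for all
`x, y ∈ E`. -/
theorem real_rank_zero_orthogonality_preserving_pair
    {A E F : Type*} [CStarAlgebra A] [PartialOrder A] [StarOrderedRing A]
    [NormedAddCommGroup E] [Module ℂ E] [SMul A E] [CompleteSpace E]
    [NormedAddCommGroup F] [Module ℂ F] [SMul A F] [CompleteSpace F]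
    (hRR0 : ∀ a : A, IsSelfAdjoint a → ∀ ε : ℝ, 0 < ε →
      ∃ b : A, IsSelfAdjoint b ∧ IsUnit b ∧ ‖a - b‖ < ε)
    (ME : CStarNormedInnerProductModule A E) (MF : CStarNormedInnerProductModule A F)
    (T S : E → F)
    (hTadd : ∀ x y : E, T (x + y) = T x + T y)
    (hTsmulC : ∀ (c : ℂ) (x : E), T (c • x) = c • T x)
    (hTsmulA : ∀ (a : A) (x : E), T (a • x) = a • T x)
    (hSadd : ∀ x y : E, S (x + y) = S x + S y)
    (hSsmulC : ∀ (c : ℂ) (x : E), S (c • x) = c • S x)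
    (hSsmulA : ∀ (a : A) (x : E), S (a • x) = a • S x)
    (hTS : ∀ x y : E, ME.inner x y = 0 → MF.inner (T x) (S y) = 0)
    (z : E) (hz : IsUnit (ME.inner z z)) (hTSz : IsSelfAdjoint (MF.inner (T z) (S z))) :
    ∃ γ : A, IsSelfAdjoint γ ∧ γ ∈ Set.center A ∧
      ∀ x y : E, MF.inner (T x) (S y) = γ * ME.inner x y := by
  obtain ⟨h, hh, hw⟩ := ME.exists_smul_inner_self_eq_one hz
  have smul_left : ∀ (a : A) x y, MF.inner (T (a • x)) (S y) = a * MF.inner (T x) (S y) :=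
    fun a x y => by rw [hTsmulA, MF.smulA_left]
  have smul_right : ∀ (a : A) x y,
      MF.inner (T x) (S (a • y)) = MF.inner (T x) (S y) * star a :=
    fun a x y => by rw [hSsmulA, MF.inner_smul_right]
  have hcenter : MF.inner (T (h • z)) (S (h • z)) ∈ Set.center A := by
    refine mem_center_of_mul_eq_zero_imp hRR0 fun a b hab => ?_
    have hort := hTS (a • h • z) (star b • h • z)
      (by rw [ME.smulA_left, ME.inner_smul_right, hw, one_mul, star_star, hab])
    rwa [smul_left, smul_right, star_star, ← mul_assoc] at hort
  refine ⟨MF.inner (T (h • z)) (S (h • z)), ?_, hcenter, fun x y => ?_⟩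
  · rw [smul_left, smul_right, ← mul_assoc]
    exact hTSz.conjugate h
  · exact ME.eq_mul_inner_of_orthogonality_preserving (t := fun x y => MF.inner (T x) (S y))
      (fun x y w => by simp only [hTadd, MF.add_left])
      (fun x y w => by simp only [hSadd, MF.inner_add_right])
      smul_left smul_right hTS hw hcenter x y
end
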